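/- arXiv:2305.03644 — 2 statements merged into one kernel-verified Lean document; each statement's English description precedes it below -/
import Mathlib

section
/- Under the preference assumption, if n_1^{B} ∈ {1, …, n} is an equilibrium of the Boston mechanism within the restricted class of profiles and n_1^{RSD} ∈ {0, …, n} is an equilibrium of the random serial dictatorship within the restricted class of profiles, then the expected total welfare (the expected value of the sum over all agents of realized utility) at the Boston class-n_1^{B} profile is weakly higher than the expected total welfare at the RSD class-n_1^{RSD} profile. -/
/-- The object in the earliest position of report `P` (a bijection from
positions to objects) among objects not in `S`. -/
def topPick {n : ℕ} [NeZero n] (P : Equiv.Perm (Fin n)) (S : Finset (Fin n)) : Fin n :=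
  if h : (Finset.univ.filter fun p => P p ∉ S).Nonempty then
    P ((Finset.univ.filter fun p => P p ∉ S).min' h)
  else 0

/-- Objects assigned by the serial dictatorship (with reports `R` and
ordering `π`, both position-indexed) to the agents in the first `k` positions. -/
def sdAssigned {n : ℕ} [NeZero n] (R : Fin n → Equiv.Perm (Fin n))
    (π : Equiv.Perm (Fin n)) : ℕ → Finset (Fin n)
  | 0 => ∅
  | k + 1 =>
    if h : k < n then
      sdAssigned R π k ∪ {topPick (R (π ⟨k, h⟩)) (sdAssigned R π k)}
    else sdAssigned R π k

/-- Serial dictatorship allocation: given reports `R` (for each agent, a bijection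
position → object) and an ordering `π` (position → agent), agent `i` receives the object
in the earliest position of their own report among the objects not assigned to the
agents in earlier positions of `π`. -/
def sdAlloc {n : ℕ} [NeZero n] (R : Fin n → Equiv.Perm (Fin n))
    (π : Equiv.Perm (Fin n)) (i : Fin n) : Fin n :=
  topPick (R i) (sdAssigned R π (π.symm i : ℕ))

/-- The partial assignment (agent → assigned object, if any) after `k` rounds of the
Boston mechanism with reports `R` and tiebreak ordering `π` (position → agent).
In round `k+1`, every unassigned agent `i` points to the object in position `k` of their
report, and receives it iff it is unassigned and `i` is earliest in `π` among the
unassigned agents pointing to it. -/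
def bostonRounds {n : ℕ} [NeZero n] (R : Fin n → Equiv.Perm (Fin n))
    (π : Equiv.Perm (Fin n)) : ℕ → Fin n → Option (Fin n)
  | 0 => fun _ => none
  | k + 1 =>
    if h : k < n then
      fun i =>
        match bostonRounds R π k i with
        | some x => some x
        | none =>
          if (∀ j, bostonRounds R π k j ≠ some (R i ⟨k, h⟩)) ∧
              (∀ j, bostonRounds R π k j = none → R j ⟨k, h⟩ = R i ⟨k, h⟩ →
                (π.symm i : ℕ) ≤ (π.symm j : ℕ)) then
            some (R i ⟨k, h⟩)
          else none
    else bostonRounds R π k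

/-- The Boston-mechanism allocation (after all `n` rounds). -/
def bostonAlloc {n : ℕ} [NeZero n] (R : Fin n → Equiv.Perm (Fin n))
    (π : Equiv.Perm (Fin n)) (i : Fin n) : Fin n :=
  (bostonRounds R π n i).getD 0

/-- Expected utility of agent `i` under the random serial dictatorship (uniform over
the `n !` orderings), where receiving the object in position `j` of one's own report
yields utility `v x + ρ j`. -/
noncomputable def rsdEU {n : ℕ} [NeZero n] (v ρ : Fin n → ℝ)
    (R : Fin n → Equiv.Perm (Fin n)) (i : Fin n) : ℝ :=
  (∑ π : Equiv.Perm (Fin n), (v (sdAlloc R π i) + ρ ((R i).symm (sdAlloc R π i)))) /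
    (Nat.factorial n)

/-- Expected utility of agent `i` under the Boston mechanism with uniformly random
tiebreak ordering. -/
noncomputable def bostonEU {n : ℕ} [NeZero n] (v ρ : Fin n → ℝ)
    (R : Fin n → Equiv.Perm (Fin n)) (i : Fin n) : ℝ :=
  (∑ π : Equiv.Perm (Fin n), (v (bostonAlloc R π i) + ρ ((R i).symm (bostonAlloc R π i)))) /
    (Nat.factorial n)
/-- The positions/objects `{k, k+1, …, n-1}` of `Fin n`, enumerated by `Fin (n - k)`. -/
def offsetEquiv (n k : ℕ) : Fin (n - k) ≃ {x : Fin n // k ≤ (x : ℕ)} where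
  toFun p := ⟨⟨k + (p : ℕ), by have := p.isLt; omega⟩, Nat.le_add_right k p⟩
  invFun x := ⟨(x : ℕ) - k, by have := x.1.isLt; have := x.2; omega⟩
  left_inv p := by ext; simp
  right_inv x := by have := x.2; ext; simp; omega

/-- The class report ranking `x_1` first, `x_2` second, and the tail objects
`x_3, …, x_n` in positions `3, …, n` according to the common order `τ`. -/
def rsdX1Report (n : ℕ) (τ : Equiv.Perm (Fin (n - 2))) : Equiv.Perm (Fin n) :=
  τ.extendDomain (offsetEquiv n 2)

/-- The class report ranking `x_2` first, `x_1` second, and the tail objects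
`x_3, …, x_n` in positions `3, …, n` according to the common order `τ`. -/
def rsdX2Report (n : ℕ) [NeZero n] (τ : Equiv.Perm (Fin (n - 2))) : Equiv.Perm (Fin n) :=
  (rsdX1Report n τ).trans (Equiv.swap 0 1)

/-- The cyclic shift of positions `1 → 2 → ⋯ → n-1 → 1`, fixing position `0`. -/
def shiftPerm (n : ℕ) : Equiv.Perm (Fin n) :=
  (finRotate (n - 1)).extendDomain (offsetEquiv n 1)

/-- The Boston class report ranking `x_1` first, the tail objects `x_3, …, x_n` in
positions `2, …, n-1` according to the common order `τ`, and `x_2` last. -/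
def bostonX1Report (n : ℕ) (τ : Equiv.Perm (Fin (n - 2))) : Equiv.Perm (Fin n) :=
  (shiftPerm n).trans (rsdX1Report n τ)

/-- The Boston class report ranking `x_2` first, the tail objects `x_3, …, x_n` in
positions `2, …, n-1` according to the common order `τ`, and `x_1` last. -/
def bostonX2Report (n : ℕ) [NeZero n] (τ : Equiv.Perm (Fin (n - 2))) : Equiv.Perm (Fin n) :=
  (shiftPerm n).trans (rsdX2Report n τ)

/-- The RSD class-`n₁` profile with common tail order `τ`: the first `n₁` agents rank
`x_1` first and `x_2` second, the remaining agents rank `x_2` first and `x_1` second,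
and all agents place `x_3, …, x_n` in positions `3, …, n` according to `τ`. -/
def rsdClassProfile (n n₁ : ℕ) [NeZero n] (τ : Equiv.Perm (Fin (n - 2))) :
    Fin n → Equiv.Perm (Fin n) :=
  fun i => if (i : ℕ) < n₁ then rsdX1Report n τ else rsdX2Report n τ

/-- The Boston class-`n₁` profile with common tail order `τ`: for `n₁ < n`, the first
`n₁` agents rank `x_1` first and the remaining agents rank `x_2` first, all placing
`x_3, …, x_n` in positions `2, …, n-1` according to `τ` and the remaining object from
`{x_1, x_2}` last; for `n₁ = n`, all agents rank `x_1` first, `x_2` second, and the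
tail objects in positions `3, …, n` according to `τ`. -/
def bostonClassProfile (n n₁ : ℕ) [NeZero n] (τ : Equiv.Perm (Fin (n - 2))) :
    Fin n → Equiv.Perm (Fin n) :=
  if n₁ = n then fun _ => rsdX1Report n τ
  else fun i => if (i : ℕ) < n₁ then bostonX1Report n τ else bostonX2Report n τ

/-- Expected utility of agent `i` for a mechanism `mech` at a profile `prof` depending
on the common tail order `τ`, averaging uniformly over the common tail order `τ` and
the mechanism's random ordering `π`. -/
noncomputable def classEU (n : ℕ) [NeZero n]
    (mech : (Fin n → Equiv.Perm (Fin n)) → Equiv.Perm (Fin n) → Fin n → Fin n)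
    (v ρ : Fin n → ℝ) (prof : Equiv.Perm (Fin (n - 2)) → Fin n → Equiv.Perm (Fin n))
    (i : Fin n) : ℝ :=
  (∑ τ : Equiv.Perm (Fin (n - 2)), ∑ π : Equiv.Perm (Fin n),
      (v (mech (prof τ) π i) + ρ ((prof τ i).symm (mech (prof τ) π i)))) /
    (Nat.factorial (n - 2) * Nat.factorial n)

/-- Expected total welfare (sum over agents of realized utility) for mechanism `mech`
at profile `prof`, averaged over the common tail order and the random ordering. -/
noncomputable def classWelfare (n : ℕ) [NeZero n]
    (mech : (Fin n → Equiv.Perm (Fin n)) → Equiv.Perm (Fin n) → Fin n → Fin n)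
    (v ρ : Fin n → ℝ) (prof : Equiv.Perm (Fin (n - 2)) → Fin n → Equiv.Perm (Fin n)) : ℝ :=
  (∑ τ : Equiv.Perm (Fin (n - 2)), ∑ π : Equiv.Perm (Fin n), ∑ i : Fin n,
      (v (mech (prof τ) π i) + ρ ((prof τ i).symm (mech (prof τ) π i)))) /
    (Nat.factorial (n - 2) * Nat.factorial n)

/-- `n₁` is an equilibrium of RSD within the restricted class of profiles: no single
agent can strictly increase their expected utility by switching which object from
`{x_1, x_2}` they rank first, adopting the corresponding class report (with the same
common tail order), all other agents unchanged. -/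
def rsdClassEq (n n₁ : ℕ) [NeZero n] (v ρ : Fin n → ℝ) : Prop :=
  ∀ i : Fin n,
    classEU n sdAlloc v ρ
        (fun τ => Function.update (rsdClassProfile n n₁ τ) i
          (if (i : ℕ) < n₁ then rsdX2Report n τ else rsdX1Report n τ)) i ≤
      classEU n sdAlloc v ρ (fun τ => rsdClassProfile n n₁ τ) i

/-- `n₁` is an equilibrium of the Boston mechanism within the restricted class of
profiles: no single agent can strictly increase their expected utility by switching
which object from `{x_1, x_2}` they rank first, adopting the corresponding class
report (with the same common tail order), all other agents unchanged. -/
def bostonClassEq (n n₁ : ℕ) [NeZero n] (v ρ : Fin n → ℝ) : Prop :=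
  ∀ i : Fin n,
    classEU n bostonAlloc v ρ
        (fun τ => Function.update (bostonClassProfile n n₁ τ) i
          (if (i : ℕ) < n₁ then bostonX2Report n τ else bostonX1Report n τ)) i ≤
      classEU n bostonAlloc v ρ (fun τ => bostonClassProfile n n₁ τ) i

/-- The preference assumption: all agents share common fundamental values
`v x_1 > v x_2 > v x_3 = ⋯ = v x_n`. -/
def prefAssumption {n : ℕ} (v : Fin n → ℝ) : Prop :=
  (∀ j k : Fin n, j < k → (j : ℕ) < 2 → v k < v j) ∧
    (∀ j k : Fin n, 2 ≤ (j : ℕ) → 2 ≤ (k : ℕ) → v j = v k)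

section SerialDictatorship

variable {n : ℕ} [NeZero n]

theorem topPick_notMem (P : Equiv.Perm (Fin n)) {S : Finset (Fin n)} (hS : S.card < n) :
    topPick P S ∉ S := by
  have hne : (Finset.univ.filter fun p => P p ∉ S).Nonempty := by
    obtain ⟨x, hx⟩ : ∃ x, x ∉ S := by
      by_contra! h
      rw [Finset.eq_univ_iff_forall.mpr h] at hS
      simp at hS
    exact ⟨P.symm x, by simpa using hx⟩
  have h := Finset.min'_mem _ hne
  rw [topPick, dif_pos hne]
  exact (Finset.mem_filter.mp h).2

theorem topPick_eq_of_forall_lt (P : Equiv.Perm (Fin n)) {S : Finset (Fin n)} {p : Fin n}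
    (hp : P p ∉ S) (hlt : ∀ q < p, P q ∈ S) : topPick P S = P p := by
  have hne : (Finset.univ.filter fun p => P p ∉ S).Nonempty := ⟨p, by simpa using hp⟩
  rw [topPick, dif_pos hne]
  congr 1
  apply le_antisymm
  · exact Finset.min'_le _ _ (by simpa using hp)
  · refine Finset.le_min' _ _ _ fun q hq => ?_
    by_contra! hqp
    exact (Finset.mem_filter.mp hq).2 (hlt q hqp)

theorem topPick_eq_apply_zero (P : Equiv.Perm (Fin n)) {S : Finset (Fin n)} (h : P 0 ∉ S) :
    topPick P S = P 0 :=
  topPick_eq_of_forall_lt P h fun q hq => absurd hq (by simp)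

theorem topPick_congr {P Q : Equiv.Perm (Fin n)} {S : Finset (Fin n)}
    (hmem : ∀ p, P p ∈ S ↔ Q p ∈ S) (heq : ∀ p, P p ∉ S → P p = Q p) :
    topPick P S = topPick Q S := by
  by_cases hne : (Finset.univ.filter fun p => P p ∉ S).Nonempty
  · have hm := Finset.min'_mem _ hne
    set p := (Finset.univ.filter fun p => P p ∉ S).min' hne
    have hp : P p ∉ S := (Finset.mem_filter.mp hm).2
    have hlt : ∀ q < p, P q ∈ S := fun q hq => by
      by_contra hqS
      exact absurd (Finset.min'_le _ q (by simpa using hqS)) (not_le.mpr hq)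
    rw [topPick_eq_of_forall_lt P hp hlt,
      topPick_eq_of_forall_lt Q (p := p) (by rwa [← hmem]) fun q hq => (hmem q).mp (hlt q hq),
      heq p hp]
  · have hne' : ¬ (Finset.univ.filter fun p => Q p ∉ S).Nonempty := by
      simpa [hmem] using hne
    rw [topPick, topPick, dif_neg hne, dif_neg hne']

theorem sdAssigned_succ (R : Fin n → Equiv.Perm (Fin n)) (π : Equiv.Perm (Fin n)) {k : ℕ}
    (h : k < n) : sdAssigned R π (k + 1) =
      sdAssigned R π k ∪ {topPick (R (π ⟨k, h⟩)) (sdAssigned R π k)} := by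
  rw [sdAssigned, dif_pos h]

theorem card_sdAssigned_le (R : Fin n → Equiv.Perm (Fin n)) (π : Equiv.Perm (Fin n)) (k : ℕ) :
    (sdAssigned R π k).card ≤ k := by
  induction k with
  | zero => simp [sdAssigned]
  | succ k ih =>
    rw [sdAssigned]
    split_ifs
    · exact (Finset.card_union_le _ _).trans (by simpa using ih)
    · omega

theorem sdAssigned_mono (R : Fin n → Equiv.Perm (Fin n)) (π : Equiv.Perm (Fin n)) :
    Monotone (sdAssigned R π) := by
  refine monotone_nat_of_le_succ fun k => ?_
  rw [sdAssigned]
  split_ifs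
  · exact Finset.subset_union_left
  · exact le_rfl

theorem sdAlloc_injective (R : Fin n → Equiv.Perm (Fin n)) (π : Equiv.Perm (Fin n)) :
    Function.Injective (sdAlloc R π) := by
  have key : ∀ i j, π.symm i < π.symm j → sdAlloc R π i ≠ sdAlloc R π j := by
    intro i j hij heq
    have hi : sdAlloc R π i ∈ sdAssigned R π (π.symm j) := by
      refine sdAssigned_mono R π (show (π.symm i : ℕ) + 1 ≤ π.symm j from hij) ?_
      rw [sdAssigned_succ R π (π.symm i).isLt]
      simp [sdAlloc]
    refine topPick_notMem (R j)
      ((card_sdAssigned_le R π (π.symm j)).trans_lt (π.symm j).isLt) ?_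
    rw [heq] at hi
    exact hi
  intro i j heq
  rcases lt_trichotomy (π.symm i) (π.symm j) with h | h | h
  · exact absurd heq (key i j h)
  · exact π.symm.injective h
  · exact absurd heq.symm (key j i h)

theorem sdAlloc_bijective (R : Fin n → Equiv.Perm (Fin n)) (π : Equiv.Perm (Fin n)) :
    Function.Bijective (sdAlloc R π) :=
  Finite.injective_iff_bijective.mp (sdAlloc_injective R π)

theorem sdAssigned_update (R : Fin n → Equiv.Perm (Fin n)) (π : Equiv.Perm (Fin n)) (i : Fin n)
    (Q : Equiv.Perm (Fin n)) (k : ℕ) (hk : k ≤ π.symm i) :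
    sdAssigned (Function.update R i Q) π k = sdAssigned R π k := by
  induction k with
  | zero => rfl
  | succ k ih =>
    have hkn : k < n := by have := (π.symm i).isLt; omega
    have hne : π ⟨k, hkn⟩ ≠ i := by
      rintro rfl
      simp at hk
    rw [sdAssigned_succ _ _ hkn, sdAssigned_succ _ _ hkn, ih (by omega),
      Function.update_of_ne hne]

theorem sdAlloc_update_self (R : Fin n → Equiv.Perm (Fin n)) (π : Equiv.Perm (Fin n)) (i : Fin n)
    (Q : Equiv.Perm (Fin n)) :
    sdAlloc (Function.update R i Q) π i = topPick Q (sdAssigned R π (π.symm i)) := by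
  rw [sdAlloc, sdAssigned_update _ _ _ _ _ le_rfl, Function.update_self]

theorem sdAssigned_one (R : Fin n → Equiv.Perm (Fin n)) (π : Equiv.Perm (Fin n)) :
    sdAssigned R π 1 = {R (π 0) 0} := by
  rw [sdAssigned_succ R π (NeZero.pos n)]
  simp only [sdAssigned, Finset.empty_union]
  rw [topPick_eq_apply_zero _ (by simp)]
  rfl

end SerialDictatorship

section Boston

variable {n : ℕ} [NeZero n]

theorem bostonRounds_succ_eq_some_iff (R : Fin n → Equiv.Perm (Fin n)) (π : Equiv.Perm (Fin n))
    {k : ℕ} (h : k < n) (i x : Fin n) :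
    bostonRounds R π (k + 1) i = some x ↔ bostonRounds R π k i = some x ∨
      (bostonRounds R π k i = none ∧ R i ⟨k, h⟩ = x ∧ (∀ j, bostonRounds R π k j ≠ some x) ∧
        ∀ j, bostonRounds R π k j = none → R j ⟨k, h⟩ = x → π.symm i ≤ π.symm j) := by
  rw [bostonRounds, dif_pos h]
  rcases hi : bostonRounds R π k i with _ | y
  · dsimp only
    split_ifs with hc
    · constructor
      · intro hx
        obtain rfl := Option.some.inj hx
        exact Or.inr ⟨rfl, rfl, hc.1, hc.2⟩
      · rintro (hx | ⟨-, rfl, -⟩)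
        · simp at hx
        · rfl
    · constructor
      · simp
      · rintro (hx | ⟨-, rfl, h1, h2⟩)
        · simp at hx
        · exact absurd ⟨h1, fun j hj hj' => h2 j hj hj'⟩ hc
  · simp

theorem bostonRounds_some_mono (R : Fin n → Equiv.Perm (Fin n)) (π : Equiv.Perm (Fin n))
    {k l : ℕ} (hkl : k ≤ l) {i x : Fin n} (hx : bostonRounds R π k i = some x) :
    bostonRounds R π l i = some x := by
  induction l, hkl using Nat.le_induction with
  | base => exact hx
  | succ l _ ih =>
    by_cases h : l < n
    · exact (bostonRounds_succ_eq_some_iff R π h i x).mpr (Or.inl ih)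
    · rw [bostonRounds, dif_neg h]
      exact ih

theorem bostonRounds_inj (R : Fin n → Equiv.Perm (Fin n)) (π : Equiv.Perm (Fin n)) {k : ℕ}
    (hk : k ≤ n) {i j x : Fin n} (hi : bostonRounds R π k i = some x)
    (hj : bostonRounds R π k j = some x) : i = j := by
  induction k with
  | zero => simp [bostonRounds] at hi
  | succ k ih =>
    rw [bostonRounds_succ_eq_some_iff R π hk] at hi hj
    rcases hi with hi | ⟨hi, hi', hix, hil⟩ <;> rcases hj with hj | ⟨hj, hj', hjx, hjl⟩
    · exact ih (by omega) hi hj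
    · exact absurd hi (hjx i)
    · exact absurd hj (hix j)
    · exact π.symm.injective (le_antisymm (hil j hj hj') (hjl i hi hi'))

theorem exists_bostonRounds_succ_eq_some (R : Fin n → Equiv.Perm (Fin n))
    (π : Equiv.Perm (Fin n)) {k : ℕ} (h : k < n) {i : Fin n}
    (hi : bostonRounds R π k i = none) :
    ∃ j, bostonRounds R π (k + 1) j = some (R i ⟨k, h⟩) := by
  by_cases hx : ∃ j, bostonRounds R π k j = some (R i ⟨k, h⟩)
  · obtain ⟨j, hj⟩ := hx
    exact ⟨j, bostonRounds_some_mono R π k.le_succ hj⟩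
  · push Not at hx
    obtain ⟨j, hj, hmin⟩ := Finset.exists_min_image
      (Finset.univ.filter fun j => bostonRounds R π k j = none ∧ R j ⟨k, h⟩ = R i ⟨k, h⟩)
      π.symm ⟨i, by simpa using hi⟩
    simp only [Finset.mem_filter, Finset.mem_univ, true_and] at hj hmin
    exact ⟨j, (bostonRounds_succ_eq_some_iff R π h j _).mpr
      (Or.inr ⟨hj.1, hj.2, hx, fun l hl hl' => hmin l ⟨hl, hl'⟩⟩)⟩

theorem bostonRounds_ne_none (R : Fin n → Equiv.Perm (Fin n)) (π : Equiv.Perm (Fin n))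
    (i : Fin n) : bostonRounds R π n i ≠ none := by
  intro hi
  have hnone : ∀ k ≤ n, bostonRounds R π k i = none := by
    intro k hk
    rcases hx : bostonRounds R π k i with _ | x
    · rfl
    · rw [bostonRounds_some_mono R π hk hx] at hi
      simp at hi
  have hall : ∀ x, ∃ j, bostonRounds R π n j = some x := by
    intro x
    have hlt := ((R i).symm x).isLt
    obtain ⟨j, hj⟩ := exists_bostonRounds_succ_eq_some R π hlt (hnone _ hlt.le)
    exact ⟨j, bostonRounds_some_mono R π hlt (by simpa using hj)⟩
  choose f hf using hall
  have hinj : Function.Injective f := fun x y hxy => by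
    have := hf y
    rw [← hxy, hf x] at this
    exact Option.some.inj this
  obtain ⟨x, rfl⟩ := (Finite.injective_iff_surjective.mp hinj) i
  rw [hf x] at hi
  simp at hi

theorem bostonRounds_eq_some_bostonAlloc (R : Fin n → Equiv.Perm (Fin n))
    (π : Equiv.Perm (Fin n)) (i : Fin n) :
    bostonRounds R π n i = some (bostonAlloc R π i) := by
  obtain ⟨x, hx⟩ := Option.ne_none_iff_exists'.mp (bostonRounds_ne_none R π i)
  rw [bostonAlloc, hx, Option.getD_some]

theorem bostonAlloc_bijective (R : Fin n → Equiv.Perm (Fin n)) (π : Equiv.Perm (Fin n)) :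
    Function.Bijective (bostonAlloc R π) := by
  refine Finite.injective_iff_bijective.mp fun i j hij => ?_
  refine bostonRounds_inj R π le_rfl (bostonRounds_eq_some_bostonAlloc R π i) ?_
  rw [hij]
  exact bostonRounds_eq_some_bostonAlloc R π j

theorem apply_zero_of_bostonAlloc_eq (R : Fin n → Equiv.Perm (Fin n)) (π : Equiv.Perm (Fin n))
    {i x : Fin n} (hx : ∃ j, R j 0 = x) (hi : bostonAlloc R π i = x) : R i 0 = x := by
  obtain ⟨j, rfl⟩ := hx
  have hn : 0 < n := NeZero.pos n
  obtain ⟨l, hl⟩ := exists_bostonRounds_succ_eq_some R π hn (i := j) rfl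
  have hil : i = l := bostonRounds_inj R π le_rfl
    ((bostonRounds_eq_some_bostonAlloc R π i).trans (congrArg some hi))
    (bostonRounds_some_mono R π hn hl)
  subst hil
  rcases (bostonRounds_succ_eq_some_iff R π hn _ _).mp hl with h | h
  · simp [bostonRounds] at h
  · exact h.2.1

end Boston

section Reports

variable {n : ℕ} [NeZero n]

theorem Fin.val_one_of_three_le (hn : 3 ≤ n) : ((1 : Fin n) : ℕ) = 1 := by
  rw [Fin.val_one', Nat.mod_eq_of_lt (by omega)]

theorem Fin.one_ne_zero_of_three_le (hn : 3 ≤ n) : (1 : Fin n) ≠ 0 := by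
  intro h
  have := congrArg Fin.val h
  rw [Fin.val_one_of_three_le hn] at this
  simp at this

theorem rsdX1Report_zero (τ : Equiv.Perm (Fin (n - 2))) : rsdX1Report n τ 0 = 0 :=
  Equiv.Perm.extendDomain_apply_not_subtype _ _ (by simp)

theorem rsdX1Report_one (hn : 3 ≤ n) (τ : Equiv.Perm (Fin (n - 2))) : rsdX1Report n τ 1 = 1 :=
  Equiv.Perm.extendDomain_apply_not_subtype _ _ (by rw [Fin.val_one_of_three_le hn]; omega)

theorem rsdX2Report_zero (τ : Equiv.Perm (Fin (n - 2))) : rsdX2Report n τ 0 = 1 := by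
  simp [rsdX2Report, rsdX1Report_zero]

theorem rsdX2Report_one (hn : 3 ≤ n) (τ : Equiv.Perm (Fin (n - 2))) : rsdX2Report n τ 1 = 0 := by
  simp [rsdX2Report, rsdX1Report_one hn]

theorem shiftPerm_zero : shiftPerm n 0 = 0 :=
  Equiv.Perm.extendDomain_apply_not_subtype _ _ (by simp)

theorem bostonX1Report_zero (τ : Equiv.Perm (Fin (n - 2))) : bostonX1Report n τ 0 = 0 := by
  simp [bostonX1Report, shiftPerm_zero, rsdX1Report_zero]

theorem bostonX2Report_zero (τ : Equiv.Perm (Fin (n - 2))) : bostonX2Report n τ 0 = 1 := by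
  simp [bostonX2Report, shiftPerm_zero, rsdX2Report_zero]

theorem rsdX2Report_symm_apply (τ : Equiv.Perm (Fin (n - 2))) {x : Fin n} (h0 : x ≠ 0)
    (h1 : x ≠ 1) : (rsdX2Report n τ).symm x = (rsdX1Report n τ).symm x := by
  simp [rsdX2Report, Equiv.swap_apply_of_ne_of_ne h0 h1]

theorem bostonX2Report_symm_apply (τ : Equiv.Perm (Fin (n - 2))) {x : Fin n} (h0 : x ≠ 0)
    (h1 : x ≠ 1) : (bostonX2Report n τ).symm x = (bostonX1Report n τ).symm x := by
  simp [bostonX2Report, bostonX1Report, rsdX2Report_symm_apply τ h0 h1]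

theorem symm_zero_eq {P : Equiv.Perm (Fin n)} {x : Fin n} (h : P 0 = x) : P.symm x = 0 := by
  rw [← h, Equiv.symm_apply_apply]

end Reports

section Welfare

variable {n : ℕ}

theorem Fin.sum_welfare_modified (v ρ : Fin n → ℝ) (P : Equiv.Perm (Fin n)) (x₀ : Fin n)
    (r : ℝ) {σ : Fin n → Fin n} (hσ : Function.Bijective σ) :
    ∑ i, (v (σ i) + if σ i = x₀ then r else ρ (P.symm (σ i))) =
      ∑ x, v x + ∑ x, ρ x + (r - ρ (P.symm x₀)) := by
  rw [hσ.sum_comp fun x => v x + if x = x₀ then r else ρ (P.symm x)]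
  have : ∀ x, (v x + if x = x₀ then r else ρ (P.symm x)) =
      v x + ρ (P.symm x) + if x = x₀ then r - ρ (P.symm x₀) else 0 := by
    intro x
    split_ifs with h
    · subst h; ring
    · ring
  simp_rw [this]
  rw [Finset.sum_add_distrib, Finset.sum_add_distrib, Equiv.sum_comp P.symm ρ]
  simp

theorem Fin.sum_welfare_const (v ρ : Fin n → ℝ) (P : Equiv.Perm (Fin n))
    {σ : Fin n → Fin n} (hσ : Function.Bijective σ) :
    ∑ i, (v (σ i) + ρ (P.symm (σ i))) = ∑ x, v x + ∑ x, ρ x := by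
  rw [hσ.sum_comp fun x => v x + ρ (P.symm x), Finset.sum_add_distrib,
    Equiv.sum_comp P.symm ρ]

theorem factorial_mul_factorial_eq_sum :
    ((Nat.factorial (n - 2) : ℝ) * Nat.factorial n) =
      ∑ _τ : Equiv.Perm (Fin (n - 2)), ∑ _π : Equiv.Perm (Fin n), 1 := by
  simp [Fintype.card_perm]

theorem factorial_mul_factorial_pos :
    (0 : ℝ) < (Nat.factorial (n - 2) : ℝ) * Nat.factorial n := by
  positivity

theorem sum_perm_ite_symm_eq (i p q : Fin n) (c : ℝ) :
    ∑ π : Equiv.Perm (Fin n), (if π.symm i = p then c else 0) =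
      ∑ π : Equiv.Perm (Fin n), if π.symm i = q then c else 0 := by
  refine Fintype.sum_equiv (Equiv.mulRight (Equiv.swap p q)) _ _ fun π => ?_
  have : (Equiv.mulRight (Equiv.swap p q) π).symm i = q ↔ π.symm i = p := by
    rw [Equiv.symm_apply_eq, Equiv.symm_apply_eq]
    simp
  simp only [this]

variable [NeZero n]

theorem classWelfare_le {mech : (Fin n → Equiv.Perm (Fin n)) → Equiv.Perm (Fin n) → Fin n → Fin n}
    {v ρ : Fin n → ℝ} {prof : Equiv.Perm (Fin (n - 2)) → Fin n → Equiv.Perm (Fin n)} {w : ℝ}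
    (h : ∀ τ π, ∑ i, (v (mech (prof τ) π i) + ρ ((prof τ i).symm (mech (prof τ) π i))) ≤ w) :
    classWelfare n mech v ρ prof ≤ w := by
  rw [classWelfare, div_le_iff₀ factorial_mul_factorial_pos, factorial_mul_factorial_eq_sum]
  simp_rw [Finset.mul_sum, mul_one]
  exact Finset.sum_le_sum fun τ _ => Finset.sum_le_sum fun π _ => h τ π

theorem le_classWelfare {mech : (Fin n → Equiv.Perm (Fin n)) → Equiv.Perm (Fin n) → Fin n → Fin n}
    {v ρ : Fin n → ℝ} {prof : Equiv.Perm (Fin (n - 2)) → Fin n → Equiv.Perm (Fin n)} {w : ℝ}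
    (h : ∀ τ π, w ≤ ∑ i, (v (mech (prof τ) π i) + ρ ((prof τ i).symm (mech (prof τ) π i)))) :
    w ≤ classWelfare n mech v ρ prof := by
  rw [classWelfare, le_div_iff₀ factorial_mul_factorial_pos, factorial_mul_factorial_eq_sum]
  simp_rw [Finset.mul_sum, mul_one]
  exact Finset.sum_le_sum fun τ _ => Finset.sum_le_sum fun π _ => h τ π

theorem le_classEU {mech : (Fin n → Equiv.Perm (Fin n)) → Equiv.Perm (Fin n) → Fin n → Fin n}
    {v ρ : Fin n → ℝ} {prof : Equiv.Perm (Fin (n - 2)) → Fin n → Equiv.Perm (Fin n)} {i : Fin n}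
    {w : ℝ} (h : ∀ τ π, w ≤ v (mech (prof τ) π i) + ρ ((prof τ i).symm (mech (prof τ) π i))) :
    w ≤ classEU n mech v ρ prof i := by
  rw [classEU, le_div_iff₀ factorial_mul_factorial_pos, factorial_mul_factorial_eq_sum]
  simp_rw [Finset.mul_sum, mul_one]
  exact Finset.sum_le_sum fun τ _ => Finset.sum_le_sum fun π _ => h τ π

theorem sum_classEU (mech : (Fin n → Equiv.Perm (Fin n)) → Equiv.Perm (Fin n) → Fin n → Fin n)
    (v ρ : Fin n → ℝ) (prof : Equiv.Perm (Fin (n - 2)) → Fin n → Equiv.Perm (Fin n)) :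
    ∑ i, classEU n mech v ρ prof i = classWelfare n mech v ρ prof := by
  simp_rw [classEU, classWelfare]
  rw [← Finset.sum_div, Finset.sum_comm]
  congr 1
  exact Finset.sum_congr rfl fun τ _ => Finset.sum_comm

theorem rsd_classWelfare_le (hn : 3 ≤ n) {v ρ : Fin n → ℝ} (hρ : Antitone ρ) (m : ℕ) :
    classWelfare n sdAlloc v ρ (rsdClassProfile n m) ≤
      ∑ x, v x + ∑ x, ρ x + (ρ 0 - ρ 1) := by
  refine classWelfare_le fun τ π => ?_
  have hP : (rsdX1Report n τ).symm 1 = 1 := by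
    rw [Equiv.symm_apply_eq, rsdX1Report_one hn]
  rw [← congrArg ρ hP, ← Fin.sum_welfare_modified v ρ (rsdX1Report n τ) 1 (ρ 0)
    (sdAlloc_bijective (rsdClassProfile n m τ) π)]
  refine Finset.sum_le_sum fun i _ => add_le_add_right ?_ _
  generalize sdAlloc (rsdClassProfile n m τ) π i = x
  split_ifs with h1
  · exact hρ (Fin.zero_le _)
  by_cases h0 : x = 0
  · rw [h0, symm_zero_eq (rsdX1Report_zero τ)]
    exact hρ (Fin.zero_le _)
  · rw [rsdClassProfile]
    split_ifs
    · exact le_rfl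
    · rw [rsdX2Report_symm_apply τ h0 h1]

theorem boston_classWelfare_ge (hn : 3 ≤ n) {v ρ : Fin n → ℝ} (hρ : Antitone ρ) {m : ℕ}
    (hm : 1 ≤ m) (hmn : m < n) :
    ∑ x, v x + ∑ x, ρ x + (ρ 0 - ρ 1) ≤
      classWelfare n bostonAlloc v ρ (bostonClassProfile n m) := by
  refine le_classWelfare fun τ π => ?_
  have hprof : bostonClassProfile n m τ =
      fun i : Fin n => if (i : ℕ) < m then bostonX1Report n τ else bostonX2Report n τ := by
    rw [bostonClassProfile, if_neg hmn.ne]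
  have hP : 1 ≤ (bostonX1Report n τ).symm 1 := by
    have hne : (bostonX1Report n τ).symm 1 ≠ 0 := by
      rw [Ne, Equiv.symm_apply_eq, bostonX1Report_zero]
      exact Fin.one_ne_zero_of_three_le hn
    rw [Fin.le_def, Fin.val_one_of_three_le hn]
    exact Nat.one_le_iff_ne_zero.mpr fun h => hne (Fin.ext (by simpa using h))
  have hsum := Fin.sum_welfare_modified v ρ (bostonX1Report n τ) 1 (ρ 0)
    (bostonAlloc_bijective (bostonClassProfile n m τ) π)
  refine le_trans (by rw [hsum]; linarith [hρ hP]) (Finset.sum_le_sum fun i _ =>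
    add_le_add_right ?_ _)
  have hx0 : bostonAlloc (bostonClassProfile n m τ) π i = 0 →
      bostonClassProfile n m τ i 0 = 0 :=
    apply_zero_of_bostonAlloc_eq _ π ⟨0, by
      simp only [hprof]
      rw [if_pos (by rw [Fin.val_zero]; omega), bostonX1Report_zero]⟩
  have hx1 : bostonAlloc (bostonClassProfile n m τ) π i = 1 →
      bostonClassProfile n m τ i 0 = 1 :=
    apply_zero_of_bostonAlloc_eq _ π ⟨⟨n - 1, by omega⟩, by
      simp only [hprof]
      rw [if_neg (by omega), bostonX2Report_zero]⟩
  generalize bostonAlloc (bostonClassProfile n m τ) π i = x at *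
  split_ifs with h1
  · rw [h1, symm_zero_eq (hx1 h1)]
  by_cases h0 : x = 0
  · rw [h0, symm_zero_eq (hx0 h0), symm_zero_eq (bostonX1Report_zero τ)]
  · simp only [hprof]
    split_ifs
    · exact le_rfl
    · rw [bostonX2Report_symm_apply τ h0 h1]

theorem boston_classWelfare_self (v ρ : Fin n → ℝ) :
    classWelfare n bostonAlloc v ρ (bostonClassProfile n n) = ∑ x, v x + ∑ x, ρ x := by
  have h : ∀ τ π, ∑ i, (v (bostonAlloc (bostonClassProfile n n τ) π i) +
      ρ ((bostonClassProfile n n τ i).symm (bostonAlloc (bostonClassProfile n n τ) π i))) =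
        ∑ x, v x + ∑ x, ρ x := by
    intro τ π
    have hprof : ∀ i, bostonClassProfile n n τ i = rsdX1Report n τ := by
      simp [bostonClassProfile]
    simp only [hprof]
    exact Fin.sum_welfare_const v ρ _ (bostonAlloc_bijective _ π)
  exact le_antisymm (classWelfare_le fun τ π => (h τ π).le)
    (le_classWelfare fun τ π => (h τ π).ge)

theorem rsd_classWelfare_self_le (v ρ : Fin n → ℝ) :
    classWelfare n sdAlloc v ρ (rsdClassProfile n n) ≤ ∑ x, v x + ∑ x, ρ x := by
  refine classWelfare_le fun τ π => ?_
  have hprof : ∀ i, rsdClassProfile n n τ i = rsdX1Report n τ := by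
    simp [rsdClassProfile]
  simp only [hprof]
  exact (Fin.sum_welfare_const v ρ _ (sdAlloc_bijective _ π)).le

/-- If unanimously ranking `x_1` first is a Boston equilibrium, securing `x_2` by deviating is
worth no more than the average utility. -/
theorem boston_classEq_self_le (hn : 3 ≤ n) {v ρ : Fin n → ℝ} (h : bostonClassEq n n v ρ) :
    n * (v 1 + ρ 0) ≤ ∑ x, v x + ∑ x, ρ x := by
  rw [← boston_classWelfare_self, ← sum_classEU]
  have hle : ∀ i, v 1 + ρ 0 ≤ classEU n bostonAlloc v ρ (bostonClassProfile n n) i := by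
    intro i
    refine le_trans (le_classEU fun τ π => ?_) (h i)
    simp only [i.isLt, if_true]
    set R := Function.update (bostonClassProfile n n τ) i (bostonX2Report n τ)
    have hRi : R i = bostonX2Report n τ := Function.update_self ..
    have hi0 : R i 0 = 1 := by rw [hRi, bostonX2Report_zero]
    obtain ⟨j, hj⟩ := (bostonAlloc_bijective R π).2 1
    have hj0 := apply_zero_of_bostonAlloc_eq R π ⟨i, hi0⟩ hj
    have hji : j = i := by
      by_contra hne
      have hRj : R j = rsdX1Report n τ := by
        simp [R, Function.update_of_ne hne, bostonClassProfile]
      rw [hRj, rsdX1Report_zero] at hj0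
      exact Fin.one_ne_zero_of_three_le hn hj0.symm
    rw [hji] at hj
    rw [hj, symm_zero_eq hi0]
  simpa [mul_add] using Finset.sum_le_sum fun i (_ : i ∈ Finset.univ) => hle i

theorem rsd_sdAlloc_deviation_gain (hn : 3 ≤ n) {v ρ : Fin n → ℝ} (hρ : Antitone ρ) (m : ℕ)
    (τ : Equiv.Perm (Fin (n - 2))) (π : Equiv.Perm (Fin n)) {i : Fin n} (hi : ¬ (i : ℕ) < m) :
    (v (sdAlloc (rsdClassProfile n m τ) π i) +
        ρ ((rsdX2Report n τ).symm (sdAlloc (rsdClassProfile n m τ) π i))) +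
      ((if π.symm i = 0 then v 0 - v 1 else 0) - if π.symm i = 1 then ρ 0 - ρ 1 else 0) ≤
    v (sdAlloc (Function.update (rsdClassProfile n m τ) i (rsdX1Report n τ)) π i) +
      ρ ((rsdX1Report n τ).symm
        (sdAlloc (Function.update (rsdClassProfile n m τ) i (rsdX1Report n τ)) π i)) := by
  have h10 := Fin.one_ne_zero_of_three_le hn
  have hv1 := Fin.val_one_of_three_le hn
  have hR : ∀ j, rsdClassProfile n m τ j = rsdX1Report n τ ∨
      rsdClassProfile n m τ j = rsdX2Report n τ := by
    intro j
    rw [rsdClassProfile]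
    split_ifs <;> simp
  have hRi : rsdClassProfile n m τ i = rsdX2Report n τ := by rw [rsdClassProfile, if_neg hi]
  have hρ01 : ρ 1 ≤ ρ 0 := hρ (Fin.zero_le _)
  have hx10 : (rsdX1Report n τ).symm 0 = 0 := symm_zero_eq (rsdX1Report_zero τ)
  have hx11 : (rsdX1Report n τ).symm 1 = 1 := by
    rw [Equiv.symm_apply_eq, rsdX1Report_one hn]
  have hx20 : (rsdX2Report n τ).symm 0 = 1 := by
    rw [Equiv.symm_apply_eq, rsdX2Report_one hn]
  have hx21 : (rsdX2Report n τ).symm 1 = 0 := symm_zero_eq (rsdX2Report_zero τ)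
  have hlt1 : ∀ q : Fin n, q < 1 → q = 0 := fun q hq => by
    rw [Fin.lt_def, hv1] at hq
    exact Fin.ext (by rw [Fin.val_zero]; omega)
  have h1pick0 : topPick (rsdX1Report n τ) {0} = 1 := by
    rw [topPick_eq_of_forall_lt (p := 1) _ (by simp [rsdX1Report_one hn, h10])
      (fun q hq => by simp [hlt1 q hq, rsdX1Report_zero]), rsdX1Report_one hn]
  have h2pick1 : topPick (rsdX2Report n τ) {1} = 0 := by
    rw [topPick_eq_of_forall_lt (p := 1) _ (by simp [rsdX2Report_one hn, h10.symm])
      (fun q hq => by simp [hlt1 q hq, rsdX2Report_zero]), rsdX2Report_one hn]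
  have h1pick1 : topPick (rsdX1Report n τ) {1} = 0 := by
    rw [topPick_eq_apply_zero _ (by simp [rsdX1Report_zero, h10.symm]), rsdX1Report_zero]
  have h2pick0 : topPick (rsdX2Report n τ) {0} = 1 := by
    rw [topPick_eq_apply_zero _ (by simp [rsdX2Report_zero, h10]), rsdX2Report_zero]
  rw [sdAlloc_update_self, sdAlloc, hRi]
  set R := rsdClassProfile n m τ
  by_cases hp0 : π.symm i = 0
  · rw [hp0, Fin.val_zero, sdAssigned, topPick_eq_apply_zero _ (by simp),
      topPick_eq_apply_zero _ (by simp), rsdX1Report_zero, rsdX2Report_zero, hx10, hx21, if_pos rfl, if_neg h10.symm]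
    linarith
  by_cases hp1 : π.symm i = 1
  · rw [hp1, hv1, sdAssigned_one, if_pos rfl, if_neg h10]
    rcases hR (π 0) with h | h
    · rw [show R (π 0) = rsdX1Report n τ from h, rsdX1Report_zero, h1pick0, h2pick0, hx11, hx21]
      linarith
    · rw [show R (π 0) = rsdX2Report n τ from h, rsdX2Report_zero, h1pick1, h2pick1, hx10, hx20]
      linarith
  have hge : 2 ≤ (π.symm i : ℕ) := by
    by_contra! hlt
    have h0 : (π.symm i : ℕ) ≠ 0 := fun h => hp0 (Fin.ext (by simpa using h))
    exact hp1 (Fin.ext (by omega))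
  have hsub : ({0, 1} : Finset (Fin n)) ⊆ sdAssigned R π (π.symm i) := by
    refine subset_trans ?_ (sdAssigned_mono R π hge)
    rw [sdAssigned_succ R π (show 1 < n by omega), sdAssigned_one]
    rcases hR (π 0) with h | h <;> rcases hR (π ⟨1, by omega⟩) with h' | h' <;>
      simp only [R, h, h', rsdX1Report_zero, rsdX2Report_zero, h1pick0, h2pick0, h1pick1,
        h2pick1] <;>
      intro x <;> simp <;> tauto
  have hS0 : (0 : Fin n) ∈ sdAssigned R π (π.symm i) := hsub (by simp)
  have hS1 : (1 : Fin n) ∈ sdAssigned R π (π.symm i) := hsub (by simp)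
  have hnot := topPick_notMem (rsdX1Report n τ)
    ((card_sdAssigned_le R π (π.symm i)).trans_lt (π.symm i).isLt)
  have hpick : topPick (rsdX2Report n τ) (sdAssigned R π (π.symm i)) =
      topPick (rsdX1Report n τ) (sdAssigned R π (π.symm i)) := by
    have happ : ∀ p, rsdX2Report n τ p = Equiv.swap 0 1 (rsdX1Report n τ p) := fun p => rfl
    have hswap : ∀ x, x ≠ 0 → x ≠ 1 → Equiv.swap (0 : Fin n) 1 x = x := fun x h h' =>
      Equiv.swap_apply_of_ne_of_ne h h'
    symm
    refine topPick_congr (fun p => ?_) fun p hp => ?_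
    · rw [happ]
      by_cases h0 : rsdX1Report n τ p = 0
      · simp [h0, hS0, hS1]
      by_cases h1 : rsdX1Report n τ p = 1
      · simp [h1, hS0, hS1]
      rw [hswap _ h0 h1]
    · rw [happ, hswap]
      · exact fun h => hp (h ▸ hS0)
      · exact fun h => hp (h ▸ hS1)
  have hne0 := (ne_of_mem_of_not_mem hS0 hnot).symm
  have hne1 := (ne_of_mem_of_not_mem hS1 hnot).symm
  rw [hpick, rsdX2Report_symm_apply τ hne0 hne1, if_neg hp0, if_neg hp1]
  linarith

theorem not_rsdClassEq (hn : 3 ≤ n) {v ρ : Fin n → ℝ} (hρ : Antitone ρ)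
    (hgap : ρ 0 - ρ 1 < v 0 - v 1) {m : ℕ} (hm : m < n) : ¬ rsdClassEq n m v ρ := by
  intro h
  let i : Fin n := ⟨n - 1, by omega⟩
  have hi : ¬ (i : ℕ) < m := by simp only [i]; omega
  have hRi : ∀ τ, rsdClassProfile n m τ i = rsdX2Report n τ := fun τ => by
    rw [rsdClassProfile, if_neg hi]
  refine absurd (h i) (not_le.mpr ?_)
  rw [classEU, classEU, div_lt_div_iff_of_pos_right factorial_mul_factorial_pos]
  refine Finset.sum_lt_sum_of_nonempty Finset.univ_nonempty fun τ _ => ?_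
  simp only [hi, if_false, Function.update_self, hRi]
  refine lt_of_lt_of_le ?_ (Finset.sum_le_sum fun π _ =>
    rsd_sdAlloc_deviation_gain hn (v := v) hρ m τ π hi)
  rw [Finset.sum_add_distrib (g := fun π : Equiv.Perm (Fin n) => _ - _),
    Finset.sum_sub_distrib, sum_perm_ite_symm_eq i 0 1, ← Finset.sum_sub_distrib]
  refine lt_add_of_pos_right _ (Finset.sum_pos' (fun π _ => ?_) ?_)
  · split_ifs <;> linarith
  · exact ⟨Equiv.swap i 1, Finset.mem_univ _, by simpa using hgap⟩

/-- Under the preference assumption, a Boston equilibrium in which all agents rank `x_1` first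
forces the value gap between `x_1` and `x_2` to exceed the loss from a second-ranked object. -/
theorem rank_gap_lt_value_gap (hn : 3 ≤ n) {v ρ : Fin n → ℝ} (hρ : Antitone ρ)
    (hv : prefAssumption v) (h : bostonClassEq n n v ρ) : ρ 0 - ρ 1 < v 0 - v 1 := by
  have hle := boston_classEq_self_le hn h
  have hv1 := Fin.val_one_of_three_le hn
  have hρ01 : ρ 1 ≤ ρ 0 := hρ (Fin.zero_le _)
  have hone : ∀ x : Fin n, x ≠ 0 → 1 ≤ x := fun x hx => by
    rw [Fin.le_def, hv1]
    exact Nat.one_le_iff_ne_zero.mpr fun h => hx (Fin.ext (by simpa using h))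
  have hsum : ∀ f : Fin n → ℝ, f 0 + (n - 1) * f 1 = ∑ x : Fin n, if x = 0 then f 0 else f 1 := by
    intro f
    have : ∀ x : Fin n, (if x = 0 then f 0 else f 1) = f 1 + if x = 0 then f 0 - f 1 else 0 := by
      intro x
      split_ifs <;> ring
    simp_rw [this]
    rw [Finset.sum_add_distrib]
    simp
    ring
  have hρsum : ∑ x, ρ x ≤ ρ 0 + (n - 1) * ρ 1 := by
    rw [hsum]
    refine Finset.sum_le_sum fun x _ => ?_
    split_ifs with hx
    · rw [hx]
    · exact hρ (hone x hx)
  have hvsum : ∑ x, v x < v 0 + (n - 1) * v 1 := by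
    rw [hsum]
    refine Finset.sum_lt_sum (fun x _ => ?_) ⟨⟨2, hn⟩, Finset.mem_univ _, ?_⟩
    · split_ifs with hx
      · rw [hx]
      · rcases (hone x hx).eq_or_lt with rfl | hlt
        · exact le_rfl
        · exact (hv.1 1 x hlt (by omega)).le
    · rw [if_neg (by simp [Fin.ext_iff])]
      exact hv.1 1 _ (by rw [Fin.lt_def, hv1]; simp) (by omega)
  have hn' : (3 : ℝ) ≤ n := by exact_mod_cast hn
  nlinarith [mul_nonneg (sub_nonneg.mpr hn') (sub_nonneg.mpr hρ01)]

end Welfare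

/-- Under the preference assumption, if `n₁B ≥ 1` is an equilibrium of
the Boston mechanism within the restricted class of profiles and `n₁R` is an
equilibrium of the random serial dictatorship within the restricted class of profiles,
then the expected total welfare at the Boston class-`n₁B` profile is weakly higher
than the expected total welfare at the RSD class-`n₁R` profile. -/
theorem boston_class_equilibrium_welfare_dominates_rsd (n : ℕ) [NeZero n] (hn : 3 ≤ n)
    (v ρ : Fin n → ℝ) (hρ : Antitone ρ) (hv : prefAssumption v)
    (n₁R n₁B : ℕ) (hR : n₁R ≤ n) (hB1 : 1 ≤ n₁B) (hBn : n₁B ≤ n)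
    (heqB : bostonClassEq n n₁B v ρ) (heqR : rsdClassEq n n₁R v ρ) :
    classWelfare n sdAlloc v ρ (fun τ => rsdClassProfile n n₁R τ) ≤
      classWelfare n bostonAlloc v ρ (fun τ => bostonClassProfile n n₁B τ) := by
  rcases hBn.lt_or_eq with hlt | rfl
  · exact (rsd_classWelfare_le hn hρ n₁R).trans (boston_classWelfare_ge hn hρ hB1 hlt)
  · have hgap := rank_gap_lt_value_gap hn hρ hv heqB
    rcases hR.lt_or_eq with hlt | rfl
    · exact absurd heqR (not_rsdClassEq hn hρ hgap hlt)
    · exact (rsd_classWelfare_self_le v ρ).trans (boston_classWelfare_self v ρ).ge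
end

section
/- Suppose every agent other than i reports the ranking x_1, x_2, …, x_n (object x_j in position j), while agent i reports a ranking P' that places x_1, …, x_{k'−1} in positions 1, …, k'−1 and places x_{k*} in position k', where 1 ≤ k' < k* ≤ n. Then in the Boston mechanism with tiebreak ordering π: if agent i is in position ℓ ≤ k'−1 of π, agent i receives x_ℓ (which occupies position ℓ of P'); and if agent i is in position ℓ ≥ k' of π, agent i receives x_{k*} (which occupies position k' of P'). Consequently, agent i's expected utility under the Boston mechanism with uniformly random tiebreak ordering equals (1/n) · Σ_{j=1}^{k'−1} (v_i(x_j) + ρ(j)) + ((n−k'+1)/n) · (v_i(x_{k*}) + ρ(k')). -/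
/-- An assignment made in some round of the Boston mechanism is final. -/
theorem bostonRounds_eq_some_of_le {n : ℕ} [NeZero n] {R : Fin n → Equiv.Perm (Fin n)}
    {π : Equiv.Perm (Fin n)} {k m : ℕ} (hkm : k ≤ m) {i x : Fin n}
    (h : bostonRounds R π k i = some x) : bostonRounds R π m i = some x := by
  induction m, hkm using Nat.le_induction with
  | base => exact h
  | succ m _ ih =>
    rw [bostonRounds]
    split_ifs with hm
    · simp only [ih]
    · exact ih

/-- While all reports agree with the identity ranking, the `p`-th agent of the tiebreak
ordering is assigned the `p`-th object in round `p`. -/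
theorem bostonRounds_of_common_prefix {n : ℕ} [NeZero n] {R : Fin n → Equiv.Perm (Fin n)}
    (π : Equiv.Perm (Fin n)) {k : ℕ} (hk : k ≤ n)
    (hR : ∀ j p : Fin n, (p : ℕ) < k → R j p = p) (j : Fin n) :
    bostonRounds R π k j = if (π.symm j : ℕ) < k then some (π.symm j) else none := by
  induction k generalizing j with
  | zero => simp [bostonRounds]
  | succ k ih =>
    have ih := ih (by omega) fun j p hp => hR j p (by omega)
    have hkn : k < n := by omega
    have hRk : ∀ j, R j ⟨k, hkn⟩ = ⟨k, hkn⟩ := fun j => hR j _ (Nat.lt_succ_self k)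
    simp only [bostonRounds, dif_pos hkn, hRk, ih]
    rcases lt_trichotomy (π.symm j : ℕ) k with hj | hj | hj
    · simp [hj, Nat.lt_succ_of_lt hj]
    · have hjk : π.symm j = ⟨k, hkn⟩ := Fin.ext hj
      rw [if_neg (show ¬ (π.symm j : ℕ) < k by omega),
        if_pos (show (π.symm j : ℕ) < k + 1 by omega)]
      dsimp only
      rw [if_pos, hjk]
      refine ⟨fun a ha => ?_, fun a ha _ => ?_⟩
      · split_ifs at ha with hak
        have := congrArg Fin.val (Option.some.inj ha)
        simp only at this
        omega
      · split_ifs at ha with hak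
        omega
    · rw [if_neg (show ¬ (π.symm j : ℕ) < k by omega),
        if_neg (show ¬ (π.symm j : ℕ) < k + 1 by omega)]
      dsimp only
      rw [if_neg]
      rintro ⟨-, h⟩
      have := h (π ⟨k, hkn⟩) (by simp) trivial
      simp only [Equiv.symm_apply_apply] at this
      omega

/-- The position of a fixed element in a uniformly random permutation is uniform. -/
theorem card_mul_sum_perm_symm_apply {α : Type*} [Fintype α] [DecidableEq α]
    (f : α → ℝ) (i : α) :
    (Fintype.card α : ℝ) * ∑ π : Equiv.Perm α, f (π.symm i) =
      (Fintype.card α).factorial * ∑ a, f a := by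
  have hsymm : ∀ j, ∑ π : Equiv.Perm α, f (π.symm j) = ∑ π : Equiv.Perm α, f (π.symm i) := by
    intro j
    refine Fintype.sum_equiv (Equiv.mulLeft (Equiv.swap i j)) _ _ fun π => ?_
    simp [← Equiv.Perm.inv_def, mul_inv_rev]
  calc (Fintype.card α : ℝ) * ∑ π : Equiv.Perm α, f (π.symm i)
      = ∑ j, ∑ π : Equiv.Perm α, f (π.symm j) := by simp [hsymm]
    _ = ∑ π : Equiv.Perm α, ∑ j, f (π.symm j) := Finset.sum_comm
    _ = ∑ _π : Equiv.Perm α, ∑ a, f a :=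
        Finset.sum_congr rfl fun π _ => Equiv.sum_comp π.symm f
    _ = (Fintype.card α).factorial * ∑ a, f a := by simp [Fintype.card_perm]

/-- Suppose every agent other than `i` reports the identity ranking
`x_1, …, x_n`, while agent `i` reports `P'` placing `x_1, …, x_{k'-1}` in positions
`1, …, k'-1` and `x_{k*}` in position `k'` (0-indexed: positions `p < k'` hold
matching objects, position `k'` holds `k* > k'`).  Then in the Boston mechanism with
tiebreak ordering `π`, writing `ℓ = π.symm i` for `i`'s position: if `ℓ < k'` then `i`
receives `x_ℓ`, and if `ℓ ≥ k'` then `i` receives `x_{k*}`.  Consequently `i`'s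
expected utility under the Boston mechanism with uniformly random tiebreak ordering is
`(1/n) Σ_{j=1}^{k'-1} (v(x_j) + ρ(j)) + ((n-k'+1)/n) (v(x_{k*}) + ρ(k'))`. -/
theorem boston_deviation_allocation_and_expected_utility (n : ℕ) [NeZero n]
    (v ρ : Fin n → ℝ) (hρ : Antitone ρ) (i : Fin n)
    (P' : Equiv.Perm (Fin n)) (R : Fin n → Equiv.Perm (Fin n))
    (hR : ∀ j, j ≠ i → R j = Equiv.refl (Fin n)) (hRi : R i = P')
    (k' kstar : Fin n) (hkk : k' < kstar)
    (hlow : ∀ p : Fin n, (p : ℕ) < (k' : ℕ) → P' p = p)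
    (hk' : P' k' = kstar) :
    (∀ π : Equiv.Perm (Fin n),
      ((π.symm i : ℕ) < (k' : ℕ) → bostonAlloc R π i = π.symm i) ∧
      ((k' : ℕ) ≤ (π.symm i : ℕ) → bostonAlloc R π i = kstar)) ∧
    bostonEU v ρ R i =
      (∑ j ∈ Finset.univ.filter (fun j : Fin n => (j : ℕ) < (k' : ℕ)), (v j + ρ j)) / n +
        (((n : ℝ) - (k' : ℕ)) / n) * (v kstar + ρ k') := by
  have hprefix : ∀ j p : Fin n, (p : ℕ) < k' → R j p = p := by
    intro j p hp
    by_cases hj : j = i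
    · rw [hj, hRi, hlow p hp]
    · simp [hR j hj]
  have hrounds := fun π => bostonRounds_of_common_prefix π k'.isLt.le hprefix
  have halloc : ∀ π : Equiv.Perm (Fin n),
      ((π.symm i : ℕ) < (k' : ℕ) → bostonAlloc R π i = π.symm i) ∧
      ((k' : ℕ) ≤ (π.symm i : ℕ) → bostonAlloc R π i = kstar) := by
    refine fun π => ⟨fun h => ?_, fun h => ?_⟩
    · have hi : bostonRounds R π k' i = some (π.symm i) := by rw [hrounds, if_pos h]
      simp [bostonAlloc, bostonRounds_eq_some_of_le k'.isLt.le hi]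
    · have hi : bostonRounds R π (k' + 1) i = some kstar := by
        simp only [bostonRounds, dif_pos k'.isLt, hrounds, if_neg (not_lt.mpr h), hRi, hk',
          Fin.eta]
        rw [if_pos]
        refine ⟨fun a ha => ?_, fun a _ ha => ?_⟩
        · split_ifs at ha with hak
          have := congrArg Fin.val (Option.some.inj ha)
          have := Fin.lt_def.mp hkk
          omega
        · by_cases hai : a = i
          · rw [hai]
          · rw [hR a hai] at ha
            exact absurd ha hkk.ne
      simp [bostonAlloc, bostonRounds_eq_some_of_le k'.isLt hi]
  refine ⟨halloc, ?_⟩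
  set f : Fin n → ℝ := fun l => if (l : ℕ) < k' then v l + ρ l else v kstar + ρ k' with hf
  have hutil : ∀ π : Equiv.Perm (Fin n),
      v (bostonAlloc R π i) + ρ ((R i).symm (bostonAlloc R π i)) = f (π.symm i) := by
    intro π
    by_cases h : (π.symm i : ℕ) < k'
    · rw [(halloc π).1 h, hRi, P'.symm_apply_eq.mpr (hlow _ h).symm]
      exact (if_pos h).symm
    · rw [(halloc π).2 (not_lt.mp h), hRi, P'.symm_apply_eq.mpr hk'.symm]
      exact (if_neg h).symm
  have hcard : ((Finset.univ.filter fun l : Fin n => ¬ (l : ℕ) < k').card : ℝ) = n - (k' : ℕ) := by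
    have : (Finset.univ.filter fun l : Fin n => ¬ (l : ℕ) < k') = Finset.Ici k' := by
      ext l; simp
    rw [this, Fin.card_Ici, Nat.cast_sub k'.isLt.le]
  have hsum : ∑ l, f l =
      ∑ j ∈ Finset.univ.filter (fun j : Fin n => (j : ℕ) < (k' : ℕ)), (v j + ρ j) +
        ((n : ℝ) - (k' : ℕ)) * (v kstar + ρ k') := by
    rw [hf, Finset.sum_ite, Finset.sum_const, nsmul_eq_mul, hcard]
  have hn : (n : ℝ) ≠ 0 := Nat.cast_ne_zero.mpr (NeZero.ne n)
  have hfact : (n.factorial : ℝ) ≠ 0 := Nat.cast_ne_zero.mpr n.factorial_ne_zero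
  have hunif := card_mul_sum_perm_symm_apply f i
  rw [Fintype.card_fin, hsum] at hunif
  rw [bostonEU, Finset.sum_congr rfl fun π _ => hutil π, div_mul_eq_mul_div, ← add_div,
    div_eq_div_iff hfact hn]
  linarith
end
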